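/- Among all rooted trees with N vertices and n leaves, the rooted broom B_{N−n−1,n} has the maximum ancestral spectral radius, and ρ_C(B_{N−n−1,n}) = n(N − n − 1) + 1. -/

import Mathlib

open Matrix

/-- A rooted tree on a finite vertex type `V`, encoded by its root and the
parent function: the root is its own parent, and iterating the parent function
from any vertex eventually reaches the root.  (These conditions force the graph
whose edges join each non-root vertex to its parent to be a tree.) -/
structure TreeOn (V : Type) [Fintype V] [DecidableEq V] where
  root : V
  parent : V → V
  parent_root : parent root = root
  reaches : ∀ v, ∃ k, parent^[k] v = root

namespace TreeOn

variable {V : Type} [Fintype V] [DecidableEq V]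

/-- `u` is a (weak) ancestor of `v`: some iterate of the parent function sends
`v` to `u`.  (Any ancestor is reached within `Fintype.card V` steps, so the
bound makes the predicate decidable without changing its meaning.) -/
def IsAncestor (T : TreeOn V) (u v : V) : Prop :=
  ∃ k, k ≤ Fintype.card V ∧ T.parent^[k] v = u

instance (T : TreeOn V) (u v : V) : Decidable (T.IsAncestor u v) := by
  have h : T.IsAncestor u v ↔ ∃ k ∈ Finset.range (Fintype.card V + 1), T.parent^[k] v = u := by
    simp [IsAncestor, Nat.lt_succ_iff]
  rw [h]; infer_instance

/-- The level of a vertex: its distance to the root. -/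
def level (T : TreeOn V) (v : V) : ℕ := Nat.find (T.reaches v)

/-- The ancestral level `ℓ(v ∨ w)`: the level of the lowest common ancestor
of `v` and `w`, i.e. the greatest level of a common ancestor. -/
def lcaLevel (T : TreeOn V) (v w : V) : ℕ :=
  (Finset.univ.filter fun u => T.IsAncestor u v ∧ T.IsAncestor u w).sup T.level

/-- A leaf is a vertex with no children. -/
def IsLeaf (T : TreeOn V) (v : V) : Prop := ∀ u, T.parent u = v → u = v

instance (T : TreeOn V) : DecidablePred T.IsLeaf := fun v =>
  inferInstanceAs (Decidable (∀ u, T.parent u = v → u = v))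

/-- The type of leaves of `T`. -/
abbrev Leaf (T : TreeOn V) := {v : V // T.IsLeaf v}

/-- The ancestral matrix `C(T)`, indexed by the leaves of `T`, whose
`(v, w)` entry is the ancestral level `ℓ(v ∨ w)`. -/
noncomputable def ancMatrix (T : TreeOn V) : Matrix T.Leaf T.Leaf ℝ :=
  Matrix.of fun v w => (T.lcaLevel v.1 w.1 : ℝ)

/-- The ancestral spectral radius `ρ_C(T)`: the largest eigenvalue of `C(T)`. -/
noncomputable def rhoC (T : TreeOn V) : ℝ :=
  sSup {μ : ℝ | ∃ x : T.Leaf → ℝ, x ≠ 0 ∧ T.ancMatrix.mulVec x = μ • x}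

/-- The underlying simple graph of the tree: each non-root vertex is joined
to its parent. -/
def graph (T : TreeOn V) : SimpleGraph V :=
  SimpleGraph.fromRel fun u v => T.parent u = v ∧ u ≠ v

/-- The number of children (outdegree) of a vertex. -/
def childCount (T : TreeOn V) (v : V) : ℕ :=
  (Finset.univ.filter fun u => T.parent u = v ∧ u ≠ v).card

end TreeOn

namespace TreeOn

variable {V : Type} [Fintype V] [DecidableEq V]

/-- `T` is a rooted broom `B_{m,n}`: all of its leaves are attached to a common
vertex, which is the far end of a path starting at the root.  (For a tree with
`N` vertices and `n` leaves, requiring all leaves to have the same parent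
already forces the remaining vertices to form such a path.) -/
def IsBroom (T : TreeOn V) : Prop :=
  ∃ p : V, ∀ u : V, T.IsLeaf u → T.parent u = p

end TreeOn

namespace TreeOn

section Helpers

variable {V : Type} [Fintype V] [DecidableEq V] (T : TreeOn V)

theorem level_spec' (v : V) : T.parent^[T.level v] v = T.root := Nat.find_spec (T.reaches v)

theorem level_le' {v : V} {k : ℕ} (h : T.parent^[k] v = T.root) : T.level v ≤ k :=
  Nat.find_min' (T.reaches v) h

theorem level_eq_zero' {v : V} : T.level v = 0 ↔ v = T.root := by
  constructor
  · intro h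
    have := T.level_spec' v
    rw [h] at this
    exact this
  · intro h
    have := T.level_le' (v := v) (k := 0) h
    omega

theorem level_parent' (v : V) : T.level (T.parent v) = T.level v - 1 := by
  by_cases hv : v = T.root
  · have h0 := T.level_eq_zero'.2 hv
    rw [hv, T.parent_root, ← hv, h0]
  · have h0 : T.level v ≠ 0 := fun h => hv (T.level_eq_zero'.1 h)
    obtain ⟨m, hm⟩ := Nat.exists_eq_succ_of_ne_zero h0
    have h1 := T.level_spec' v
    rw [hm, Function.iterate_succ_apply] at h1
    have h2 := T.level_le' h1
    have h3 := T.level_spec' (T.parent v)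
    rw [← Function.iterate_succ_apply] at h3
    have h4 := T.level_le' h3
    omega

theorem level_iterate' (k : ℕ) (v : V) : T.level (T.parent^[k] v) = T.level v - k := by
  induction k with
  | zero => simp
  | succ k ih => rw [Function.iterate_succ_apply', level_parent', ih]; omega

theorem eq_root_of_leaf_root' (h : T.IsLeaf T.root) (k : ℕ) :
    ∀ w, T.parent^[k] w = T.root → w = T.root := by
  induction k with
  | zero => intro w hw; exact hw
  | succ k ih =>
    intro w hw
    rw [Function.iterate_succ_apply] at hw
    exact h w (ih _ hw)

theorem card_nonleaf' :
    ((Finset.univ.filter fun u => ¬ T.IsLeaf u).card) + Fintype.card T.Leaf = Fintype.card V := by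
  rw [Fintype.card_subtype, add_comm]
  exact Finset.card_filter_add_card_filter_not (s := Finset.univ) _

theorem level_add_card_leaf_le' (v : V) : T.level v + Fintype.card T.Leaf ≤ Fintype.card V := by
  rw [← T.card_nonleaf']
  have : (Finset.range (T.level v)).card ≤ (Finset.univ.filter fun u => ¬ T.IsLeaf u).card := by
    apply Finset.card_le_card_of_injOn (fun k => T.parent^[k+1] v)
    · intro k hk
      have hk : k < T.level v := by simpa using hk
      have h1 := T.level_iterate' k v
      have h2 := T.level_iterate' (k+1) v
      simp only [Finset.coe_filter, Finset.mem_univ, true_and, Set.mem_setOf_eq]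
      intro hl
      have := hl (T.parent^[k] v) (Function.iterate_succ_apply' _ _ _).symm
      rw [this] at h1
      omega
    · intro i hi j hj hij
      have hi : i < T.level v := by simpa using hi
      have hj : j < T.level v := by simpa using hj
      have h := congrArg T.level hij
      simp only [level_iterate'] at h
      omega
  simpa using this

theorem lca_self_le' (v : V) : T.lcaLevel v v + Fintype.card T.Leaf ≤ Fintype.card V := by
  refine le_trans (Nat.add_le_add_right ?_ _) (T.level_add_card_leaf_le' v)
  apply Finset.sup_le
  intro u hu
  obtain ⟨k, -, hk⟩ := (Finset.mem_filter.1 hu).2.1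
  rw [← hk, level_iterate']
  omega

theorem lca_ne_le' {v w : V} (hv : T.IsLeaf v) (hw : T.IsLeaf w) (h : v ≠ w) :
    T.lcaLevel v w + 1 + Fintype.card T.Leaf ≤ Fintype.card V := by
  have key : ∀ a b : V, T.IsLeaf a → a ≠ b → T.level a ≠ 0 := by
    intro a b ha hab h0
    have h0 := T.level_eq_zero'.1 h0
    obtain ⟨k, hk⟩ := T.reaches b
    exact hab (h0.trans (T.eq_root_of_leaf_root' (h0 ▸ ha) k b hk).symm)
  have hv0 := key v w hv h
  have hw0 := key w v hw h.symm
  have hv1 := T.level_add_card_leaf_le' v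
  have hw1 := T.level_add_card_leaf_le' w
  suffices T.lcaLevel v w ≤ Fintype.card V - Fintype.card T.Leaf - 1 by omega
  apply Finset.sup_le
  intro u hu
  obtain ⟨⟨k, -, hk⟩, ⟨j, -, hj⟩⟩ := (Finset.mem_filter.1 hu).2
  have h1 := T.level_iterate' k v
  have h2 := T.level_iterate' j w
  rw [hk] at h1
  rw [hj] at h2
  rcases Nat.eq_zero_or_pos k with rfl | hk0
  · rcases Nat.eq_zero_or_pos j with rfl | hj0
    · exact absurd (hk.trans hj.symm) h
    · omega
  · omega

theorem exists_leaf' (u : V) : ∃ w k, T.IsLeaf w ∧ T.parent^[k] w = u := by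
  classical
  obtain ⟨w, hw, hmax⟩ := Finset.exists_max_image
    (Finset.univ.filter fun w => ∃ k, T.parent^[k] w = u) T.level
    ⟨u, by simp only [Finset.mem_filter, Finset.mem_univ, true_and]; exact ⟨0, rfl⟩⟩
  obtain ⟨k, hk⟩ := (Finset.mem_filter.1 hw).2
  refine ⟨w, k, ?_, hk⟩
  intro x hx
  have h1 := hmax x (by
    simp only [Finset.mem_filter, Finset.mem_univ, true_and]
    exact ⟨k+1, by rw [Function.iterate_succ_apply, hx, hk]⟩)
  have h2 := T.level_parent' x
  rw [hx] at h2
  have h3 := T.level_eq_zero'.1 (show T.level x = 0 by omega)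
  rw [← hx, h3, T.parent_root]

theorem broom_card_le' {p : V} (hp : ∀ u : V, T.IsLeaf u → T.parent u = p) {v : V}
    (hv : T.IsLeaf v) : Fintype.card V ≤ T.level v + Fintype.card T.Leaf := by
  rw [← T.card_nonleaf']
  have : (Finset.univ.filter fun u => ¬ T.IsLeaf u) ⊆
      (Finset.range (T.level v)).image (fun k => T.parent^[k+1] v) := by
    intro u hu
    have hu := (Finset.mem_filter.1 hu).2
    obtain ⟨w, j, hw, hj⟩ := T.exists_leaf' u
    rcases j with _ | j
    · exact absurd hw (by rw [show w = u from hj]; exact hu)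
    have hj' : T.parent^[j+1] v = u := by
      rw [Function.iterate_succ_apply] at hj ⊢
      rw [hp v hv, ← hp w hw, hj]
    rw [Finset.mem_image]
    by_cases hlt : j < T.level v
    · exact ⟨j, by simpa using hlt, hj'⟩
    · have h1 := T.level_iterate' (j+1) v
      rw [hj'] at h1
      have hur := T.level_eq_zero'.1 (show T.level u = 0 by omega)
      have h0 : T.level v ≠ 0 := by
        intro h0
        have := T.level_eq_zero'.1 h0
        rw [this, ← hur] at hv
        exact hu hv
      refine ⟨T.level v - 1, by simp; omega, ?_⟩
      have h2 := T.level_spec' v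
      rw [hur, ← h2]
      congr 2
      omega
  have h := (Finset.card_le_card this).trans Finset.card_image_le
  simpa using h

theorem broom_le_lca_self' {p : V} (hp : ∀ u : V, T.IsLeaf u → T.parent u = p) {v : V}
    (hv : T.IsLeaf v) : Fintype.card V ≤ T.lcaLevel v v + Fintype.card T.Leaf := by
  refine (T.broom_card_le' hp hv).trans (Nat.add_le_add_right ?_ _)
  apply Finset.le_sup (f := T.level)
  simp only [Finset.mem_filter, Finset.mem_univ, true_and, and_self]
  exact ⟨0, Nat.zero_le _, rfl⟩

theorem broom_le_lca' {p : V} (hp : ∀ u : V, T.IsLeaf u → T.parent u = p) {v w : V}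
    (hv : T.IsLeaf v) (hw : T.IsLeaf w) :
    Fintype.card V ≤ T.lcaLevel v w + 1 + Fintype.card T.Leaf := by
  have h1 := T.broom_card_le' hp hv
  have h2 := T.level_parent' v
  have hc : 1 ≤ Fintype.card V := Fintype.card_pos_iff.2 ⟨v⟩
  have h3 : T.level (T.parent v) ≤ T.lcaLevel v w := by
    apply Finset.le_sup (f := T.level)
    simp only [Finset.mem_filter, Finset.mem_univ, true_and]
    exact ⟨⟨1, hc, rfl⟩, ⟨1, hc, by rw [Function.iterate_one, hp v hv, hp w hw]⟩⟩
  omega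

/-- The claimed value of the maximum. -/
noncomputable def bd' : ℝ :=
  (Fintype.card T.Leaf : ℝ) * ((Fintype.card V : ℝ) - (Fintype.card T.Leaf : ℝ) - 1) + 1

theorem sum_model' (v : T.Leaf) :
    ∑ w : T.Leaf, (((Fintype.card V : ℝ) - (Fintype.card T.Leaf : ℝ) - 1) + if v = w then 1 else 0)
      = T.bd' := by
  rw [Finset.sum_add_distrib, Finset.sum_ite_eq, Finset.sum_const, bd']
  simp

theorem entry_le' (v w : T.Leaf) :
    T.ancMatrix v w ≤ ((Fintype.card V : ℝ) - (Fintype.card T.Leaf : ℝ) - 1)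
      + if v = w then 1 else 0 := by
  simp only [ancMatrix, Matrix.of_apply]
  split_ifs with h
  · subst h
    have h : ((T.lcaLevel v.1 v.1 + Fintype.card T.Leaf : ℕ) : ℝ) ≤ (Fintype.card V : ℝ) := by
      exact_mod_cast T.lca_self_le' v.1
    push_cast at h
    linarith
  · have h : ((T.lcaLevel v.1 w.1 + 1 + Fintype.card T.Leaf : ℕ) : ℝ) ≤ (Fintype.card V : ℝ) := by
      exact_mod_cast T.lca_ne_le' v.2 w.2 (fun h' => h (Subtype.ext h'))
    push_cast at h
    linarith

theorem entry_nonneg' (v w : T.Leaf) : 0 ≤ T.ancMatrix v w := by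
  simp only [ancMatrix, Matrix.of_apply]
  positivity

theorem row_le' (v : T.Leaf) : ∑ w, T.ancMatrix v w ≤ T.bd' := by
  rw [← T.sum_model' v]
  exact Finset.sum_le_sum fun w _ => T.entry_le' v w

theorem eig_le' {μ : ℝ} {x : T.Leaf → ℝ} (hx : x ≠ 0) (h : T.ancMatrix.mulVec x = μ • x) :
    μ ≤ T.bd' := by
  obtain ⟨i0, hi0⟩ := Function.ne_iff.1 hx
  obtain ⟨i, -, hi⟩ := Finset.exists_max_image (Finset.univ : Finset T.Leaf) (fun i => |x i|)
    ⟨i0, Finset.mem_univ _⟩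
  have hpos : 0 < |x i| := lt_of_lt_of_le (abs_pos.2 hi0) (hi i0 (Finset.mem_univ _))
  have h1 : ∑ j, T.ancMatrix i j * x j = μ * x i := congrFun h i
  have h2 : |μ * x i| ≤ T.bd' * |x i| := by
    rw [← h1]
    calc |∑ j, T.ancMatrix i j * x j| ≤ ∑ j, |T.ancMatrix i j * x j| :=
          Finset.abs_sum_le_sum_abs _ _
      _ ≤ ∑ j, T.ancMatrix i j * |x i| := by
          apply Finset.sum_le_sum
          intro j _
          rw [abs_mul, abs_of_nonneg (T.entry_nonneg' i j)]
          exact mul_le_mul_of_nonneg_left (hi j (Finset.mem_univ _)) (T.entry_nonneg' i j)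
      _ = (∑ j, T.ancMatrix i j) * |x i| := by rw [Finset.sum_mul]
      _ ≤ _ := mul_le_mul_of_nonneg_right (T.row_le' i) hpos.le
  rw [abs_mul] at h2
  exact (le_abs_self μ).trans (le_of_mul_le_mul_right h2 hpos)

theorem leaf_nonempty' : Nonempty T.Leaf := by
  obtain ⟨w, _, hw, _⟩ := T.exists_leaf' T.root
  exact ⟨⟨w, hw⟩⟩

theorem rhoC_le' : T.rhoC ≤ T.bd' := by
  obtain ⟨v⟩ := T.leaf_nonempty'
  apply Real.sSup_le
  · rintro μ ⟨x, hx, h⟩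
    exact T.eig_le' hx h
  · exact (Finset.sum_nonneg fun w _ => T.entry_nonneg' v w).trans (T.row_le' v)

theorem broom_rhoC' (hB : T.IsBroom) : T.rhoC = T.bd' := by
  apply le_antisymm T.rhoC_le'
  obtain ⟨p, hp⟩ := hB
  obtain ⟨v0⟩ := T.leaf_nonempty'
  apply le_csSup
  · refine ⟨T.bd', ?_⟩
    rintro μ ⟨x, hx, h⟩
    exact T.eig_le' hx h
  · refine ⟨fun _ => 1, fun h => one_ne_zero (congrFun h v0), ?_⟩
    funext v
    have hrow : ∑ w, T.ancMatrix v w = T.bd' := by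
      apply le_antisymm (T.row_le' v)
      rw [← T.sum_model' v]
      apply Finset.sum_le_sum
      intro w _
      simp only [ancMatrix, Matrix.of_apply]
      split_ifs with h
      · subst h
        have h : (Fintype.card V : ℝ) ≤ ((T.lcaLevel v.1 v.1 + Fintype.card T.Leaf : ℕ) : ℝ) := by
          exact_mod_cast T.broom_le_lca_self' hp v.2
        push_cast at h
        linarith
      · have h : (Fintype.card V : ℝ) ≤
            ((T.lcaLevel v.1 w.1 + 1 + Fintype.card T.Leaf : ℕ) : ℝ) := by
          exact_mod_cast T.broom_le_lca' hp v.2 w.2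
        push_cast at h
        linarith
    simp [Matrix.mulVec, dotProduct, hrow]

end Helpers

end TreeOn

/-- Among all rooted trees with `N` vertices and `n` leaves,
the rooted broom `B_{N−n−1,n}` maximises the ancestral spectral radius, and
its ancestral spectral radius equals `n(N − n − 1) + 1`. -/
theorem rhoC_le_rhoC_broom
    {V W : Type} [Fintype V] [DecidableEq V] [Fintype W] [DecidableEq W]
    (N n : ℕ) (T : TreeOn V) (B : TreeOn W)
    (hTN : Fintype.card V = N) (hTn : Fintype.card T.Leaf = n)
    (hBN : Fintype.card W = N) (hBn : Fintype.card B.Leaf = n)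
    (hB : B.IsBroom) :
    T.rhoC ≤ B.rhoC ∧ B.rhoC = (n : ℝ) * ((N : ℝ) - (n : ℝ) - 1) + 1 := by
  have h1 := T.rhoC_le'
  have h2 := B.broom_rhoC' hB
  simp only [TreeOn.bd', hTN, hTn, hBN, hBn] at h1 h2
  exact ⟨h1.trans h2.ge, h2⟩
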